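/- arXiv:2110.02155 — 12 statements merged into one kernel-verified Lean document; each statement's English description precedes it below -/
import Mathlib

section
/- Let X be a nonempty finite set, let ω : X → ℝ be a probability distribution with full support (ω(x) > 0 for all x and ∑_{x∈X} ω(x) = 1), and let τ : X → ℕ satisfy τ(x) ≥ 1 for all x. Then the multinomial first-full probabilities sum to one: ∑_{x∈X} ∑_{φ} (‖φ‖! / ∏_{y∈X} φ(y)!) · (∏_{y∈X} ω(y)^{φ(y)}) · ω(x) = 1, where for each x the inner sum ranges over all functions φ : X → ℕ with φ(y) < τ(y) for every y ∈ X and φ(x) = τ(x) − 1. -/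
noncomputable def mnW {X : Type*} [Fintype X] (ω : X → ℝ) (φ : X → ℕ) : ℝ :=
  (((∑ y, φ y).factorial : ℝ) / ∏ y, ((φ y).factorial : ℝ)) * (∏ y, ω y ^ φ y)

theorem mnW_step {X : Type*} [Fintype X] [DecidableEq X] (ω : X → ℝ) (φ : X → ℕ) (x : X) :
    mnW ω φ * ω x = mnW ω (φ + Pi.single x 1) *
      ((((φ + Pi.single x 1 : X → ℕ) x : ℕ) : ℝ) / ((∑ y, (φ + Pi.single x 1 : X → ℕ) y : ℕ) : ℝ)) := by
  have h1 : ∑ y, (φ + Pi.single x 1 : X → ℕ) y = ∑ y, φ y + 1 := by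
    simp [Finset.sum_add_distrib]
  have h2 : ∏ y, ω y ^ ((φ + Pi.single x 1 : X → ℕ) y) = (∏ y, ω y ^ φ y) * ω x := by
    have : ∀ y, ω y ^ ((φ + Pi.single x 1 : X → ℕ) y) = ω y ^ φ y * (if y = x then ω x else 1) := by
      intro y
      by_cases h : y = x
      · subst h; simp [pow_succ]
      · simp [h]
    simp only [this, Finset.prod_mul_distrib]
    simp
  have h3 : ∏ y, ((((φ + Pi.single x 1 : X → ℕ) y).factorial : ℕ) : ℝ)
      = (∏ y, ((φ y).factorial : ℝ)) * ((φ x : ℝ) + 1) := by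
    have : ∀ y, ((((φ + Pi.single x 1 : X → ℕ) y).factorial : ℕ) : ℝ)
        = ((φ y).factorial : ℝ) * (if y = x then ((φ x : ℝ) + 1) else 1) := by
      intro y
      by_cases h : y = x
      · subst h; simp [Nat.factorial_succ, mul_comm]
      · simp [h]
    simp only [this, Finset.prod_mul_distrib]
    simp
  have h4 : (∏ y, ((φ y).factorial : ℝ)) ≠ 0 :=
    Finset.prod_ne_zero_iff.2 fun y _ => by positivity
  have h5 : (φ x : ℝ) + 1 ≠ 0 := by positivity
  unfold mnW
  rw [h1, h2, h3, Nat.factorial_succ]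
  have h6 : ((∑ y, φ y : ℕ) : ℝ) + 1 ≠ 0 := by positivity
  have h7 : (((φ + Pi.single x 1 : X → ℕ) x : ℕ) : ℝ) = (φ x : ℝ) + 1 := by simp
  rw [h7]
  generalize (∑ y, φ y) = n at *
  push_cast
  field_simp

/-- the multinomial first-full probabilities sum to one. -/
theorem multinomial_firstFull_sum_eq_one
    (X : Type*) [Fintype X] [DecidableEq X] [Nonempty X]
    (ω : X → ℝ) (hpos : ∀ x, 0 < ω x) (hsum : ∑ x, ω x = 1)
    (τ : X → ℕ) (hτ : ∀ x, 1 ≤ τ x) :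
    ∑ x : X,
      ∑ φ ∈ (Fintype.piFinset fun y => Finset.range (τ y)).filter
          (fun φ => φ x = τ x - 1),
        (((∑ y, φ y).factorial : ℝ) / ∏ y, ((φ y).factorial : ℝ)) *
          (∏ y, ω y ^ φ y) * ω x = 1 := by
  change ∑ x : X, ∑ φ ∈ (Fintype.piFinset fun y => Finset.range (τ y)).filter
          (fun φ => φ x = τ x - 1), mnW ω φ * ω x = 1
  set B := Fintype.piFinset fun y => Finset.range (τ y) with hB
  have hmem : ∀ φ, φ ∈ B ↔ ∀ y, φ y < τ y := by intro φ; simp [hB]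
  have key : ∀ x, ∑ φ ∈ B.filter (fun φ => ¬ φ x = τ x - 1), mnW ω φ * ω x
      = ∑ ψ ∈ B, mnW ω ψ * ((ψ x : ℝ) / ((∑ y, ψ y : ℕ) : ℝ)) := by
    intro x
    have : ∑ ψ ∈ B.filter (fun ψ => ψ x ≠ 0), mnW ω ψ * ((ψ x : ℝ) / ((∑ y, ψ y : ℕ) : ℝ))
        = ∑ ψ ∈ B, mnW ω ψ * ((ψ x : ℝ) / ((∑ y, ψ y : ℕ) : ℝ)) := by
      apply Finset.sum_filter_of_ne
      intro ψ _ h h0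
      apply h
      simp [h0]
    rw [← this]
    refine Finset.sum_bij' (fun φ _ => φ + Pi.single x 1) (fun ψ _ => ψ - Pi.single x 1)
      ?_ ?_ ?_ ?_ ?_
    · intro φ h
      rw [Finset.mem_filter, hmem] at h ⊢
      refine ⟨fun y => ?_, by simp⟩
      have := h.1 y
      by_cases hy : y = x
      · subst hy
        have := h.2
        simp; omega
      · simpa [hy] using this
    · intro φ h
      rw [Finset.mem_filter, hmem] at h ⊢
      refine ⟨fun y => lt_of_le_of_lt (by simp) (h.1 y), ?_⟩
      have := h.1 x
      have := h.2
      simp; omega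
    · intro φ h
      simp
    · intro φ h
      rw [Finset.mem_filter] at h
      funext y
      by_cases hy : y = x
      · subst hy
        have := h.2
        simp; omega
      · simp [hy]
    · intro φ h
      exact mnW_step ω φ x
  have split : ∀ x, ∑ φ ∈ B.filter (fun φ => φ x = τ x - 1), mnW ω φ * ω x
      = ∑ φ ∈ B, mnW ω φ * ω x
        - ∑ ψ ∈ B, mnW ω ψ * ((ψ x : ℝ) / ((∑ y, ψ y : ℕ) : ℝ)) := by
    intro x
    rw [← key x, ← Finset.sum_filter_add_sum_filter_not B (fun φ => φ x = τ x - 1)]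
    ring
  simp only [split]
  rw [Finset.sum_sub_distrib, Finset.sum_comm, Finset.sum_comm (s := Finset.univ) (t := B),
    ← Finset.sum_sub_distrib]
  have hz : (0 : X → ℕ) ∈ B := (hmem 0).2 fun y => hτ y
  rw [Finset.sum_eq_single_of_mem 0 hz]
  · rw [← Finset.mul_sum, hsum]
    simp [mnW]
  · intro φ _ hφ
    rw [← Finset.mul_sum, hsum, ← Finset.mul_sum, ← Finset.sum_div, ← Nat.cast_sum, div_self]
    · ring
    · intro h
      apply hφ
      have h' : ∑ y, φ y = 0 := by exact_mod_cast h
      funext y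
      exact (Finset.sum_eq_zero_iff.1 h') y (Finset.mem_univ y)
end

section
/- Let X be a nonempty finite set, let τ : X → ℕ satisfy τ(x) ≥ 1 for all x, and let υ : X → ℕ be an urn with υ(x) ≥ τ(x) for all x; write L = ∑_{x∈X} υ(x). Then the hypergeometric first-full probabilities sum to one: ∑_{x∈X} ∑_{φ} ((∏_{y∈X} C(υ(y), φ(y))) / C(L, ‖φ‖)) · ((υ(x) − φ(x)) / (L − ‖φ‖)) = 1 (as real numbers), where for each x the inner sum ranges over all φ : X → ℕ with φ(y) < τ(y) for every y ∈ X and φ(x) = τ(x) − 1, and ‖φ‖ = ∑_{y∈X} φ(y). -/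
theorem aux_choose (n k : ℕ) (h : k ≤ n) :
    (n.choose (k+1) : ℝ) * ((k : ℝ) + 1) = (n.choose k : ℝ) * ((n : ℝ) - (k : ℝ)) := by
  have := Nat.choose_succ_right_eq n k
  rw [← Nat.cast_sub h]
  exact_mod_cast this

theorem aux_sum {X : Type*} [Fintype X] [DecidableEq X] (φ : X → ℕ) (x : X) :
    ∑ y, Function.update φ x (φ x + 1) y = ∑ y, φ y + 1 := by
  rw [Finset.sum_update_of_mem (Finset.mem_univ x),
    ← Finset.add_sum_erase Finset.univ φ (Finset.mem_univ x), Finset.sdiff_singleton_eq_erase]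
  omega

theorem aux_step {X : Type*} [Fintype X] [DecidableEq X] (υ φ : X → ℕ) (x : X)
    (h : ∀ y, φ y < υ y) :
    ((∏ y, ((υ y).choose (φ y) : ℝ)) / ((∑ y, υ y).choose (∑ y, φ y) : ℝ)) *
          (((υ x : ℝ) - (φ x : ℝ)) / (((∑ y, υ y : ℕ) : ℝ) - ((∑ y, φ y : ℕ) : ℝ))) =
    ((∏ y, ((υ y).choose (Function.update φ x (φ x + 1) y) : ℝ)) /
      ((∑ y, υ y).choose (∑ y, Function.update φ x (φ x + 1) y) : ℝ)) *
      ((Function.update φ x (φ x + 1) x : ℕ) /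
        ((∑ y, Function.update φ x (φ x + 1) y : ℕ) : ℝ)) := by
  have hlt : ∑ y, φ y < ∑ y, υ y :=
    Finset.sum_lt_sum (fun i _ => (h i).le) ⟨x, Finset.mem_univ x, h x⟩
  rw [aux_sum]
  have hp : ∏ y ∈ Finset.univ.erase x, ((υ y).choose (Function.update φ x (φ x + 1) y) : ℝ)
      = ∏ y ∈ Finset.univ.erase x, ((υ y).choose (φ y) : ℝ) := by
    apply Finset.prod_congr rfl
    intro y hy
    rw [Function.update_of_ne (Finset.ne_of_mem_erase hy)]
  rw [← Finset.mul_prod_erase Finset.univ _ (Finset.mem_univ x),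
    ← Finset.mul_prod_erase Finset.univ
      (fun y => ((υ y).choose (Function.update φ x (φ x + 1) y) : ℝ)) (Finset.mem_univ x), hp]
  simp only [Function.update_self]
  have e1 := aux_choose (υ x) (φ x) (h x).le
  have e2 := aux_choose _ _ hlt.le
  generalize ∏ y ∈ Finset.univ.erase x, ((υ y).choose (φ y) : ℝ) = p
  generalize ∑ y, φ y = K at *
  generalize ∑ y, υ y = L at *
  rw [div_mul_div_comm, div_mul_div_comm, ← e2]
  push_cast
  congr 1
  linear_combination -p * e1

theorem aux_move {X : Type*} [Fintype X] [DecidableEq X] (τ : X → ℕ) (x : X)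
    (f g : (X → ℕ) → ℝ)
    (hfg : ∀ φ ∈ Fintype.piFinset fun y => Finset.range (τ y),
      f φ = g (Function.update φ x (φ x + 1)))
    (hg : ∀ φ, φ x = 0 → g φ = 0) :
    ∑ φ ∈ (Fintype.piFinset fun y => Finset.range (τ y)).filter (fun φ => ¬ φ x = τ x - 1), f φ
     = ∑ φ ∈ (Fintype.piFinset fun y => Finset.range (τ y)), g φ := by
  rw [← Finset.sum_filter_of_ne (p := fun φ : X → ℕ => φ x ≠ 0)
    (fun φ _ h h0 => h (hg φ h0))]
  refine Finset.sum_bij' (fun φ _ => Function.update φ x (φ x + 1))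
    (fun φ _ => Function.update φ x (φ x - 1)) ?_ ?_ ?_ ?_ ?_
  · intro φ hφ
    simp only [Finset.mem_filter, Fintype.mem_piFinset, Finset.mem_range] at hφ ⊢
    refine ⟨fun y => ?_, by simp⟩
    by_cases hy : y = x
    · subst hy
      have := hφ.1 y
      simp only [Function.update_self]
      omega
    · rw [Function.update_of_ne hy]; exact hφ.1 y
  · intro φ hφ
    simp only [Finset.mem_filter, Fintype.mem_piFinset, Finset.mem_range] at hφ ⊢
    have hx := hφ.1 x
    refine ⟨fun y => ?_, by simp only [Function.update_self]; omega⟩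
    by_cases hy : y = x
    · subst hy
      simp only [Function.update_self]
      omega
    · rw [Function.update_of_ne hy]; exact hφ.1 y
  · intro φ hφ
    simp
  · intro φ hφ
    have h0 := (Finset.mem_filter.1 hφ).2
    have : φ x - 1 + 1 = φ x := by omega
    simp [this]
  · intro φ hφ
    exact hfg φ (Finset.mem_filter.1 hφ).1

/-- the hypergeometric first-full probabilities sum to one. -/
theorem hypergeometric_firstFull_sum_eq_one
    (X : Type*) [Fintype X] [DecidableEq X] [Nonempty X]
    (τ υ : X → ℕ) (hτ : ∀ x, 1 ≤ τ x) (hυ : ∀ x, τ x ≤ υ x) :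
    ∑ x : X,
      ∑ φ ∈ (Fintype.piFinset fun y => Finset.range (τ y)).filter
          (fun φ => φ x = τ x - 1),
        ((∏ y, ((υ y).choose (φ y) : ℝ)) / ((∑ y, υ y).choose (∑ y, φ y) : ℝ)) *
          (((υ x : ℝ) - (φ x : ℝ)) / (((∑ y, υ y : ℕ) : ℝ) - ((∑ y, φ y : ℕ) : ℝ)))
      = 1 := by
  set P := Fintype.piFinset fun y => Finset.range (τ y) with hP
  have hlt : ∀ φ ∈ P, ∀ y, φ y < υ y := by
    intro φ hφ y
    have := Finset.mem_range.1 (Fintype.mem_piFinset.1 hφ y)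
    exact this.trans_le (hυ y)
  set w : (X → ℕ) → ℝ := fun φ =>
    (∏ y, ((υ y).choose (φ y) : ℝ)) / ((∑ y, υ y).choose (∑ y, φ y) : ℝ) with hw
  set t : X → (X → ℕ) → ℝ := fun x φ => w φ *
    (((υ x : ℝ) - (φ x : ℝ)) / (((∑ y, υ y : ℕ) : ℝ) - ((∑ y, φ y : ℕ) : ℝ))) with ht
  change ∑ x, ∑ φ ∈ P.filter (fun φ => φ x = τ x - 1), t x φ = 1
  have h1 : ∑ x, ∑ φ ∈ P, t x φ = ∑ φ ∈ P, w φ := by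
    rw [Finset.sum_comm]
    refine Finset.sum_congr rfl fun φ hφ => ?_
    simp only [ht]
    rw [← Finset.mul_sum, ← Finset.sum_div, Finset.sum_sub_distrib]
    have : ∑ y, φ y < ∑ y, υ y :=
      Finset.sum_lt_sum_of_nonempty Finset.univ_nonempty (fun i _ => hlt φ hφ i)
    have h' : ((∑ y, φ y : ℕ) : ℝ) < ((∑ y, υ y : ℕ) : ℝ) := by exact_mod_cast this
    rw [← Nat.cast_sum, ← Nat.cast_sum, div_self (sub_pos.2 h').ne', mul_one]
  have h2 : ∑ x, ∑ φ ∈ P.filter (fun φ => ¬ φ x = τ x - 1), t x φ = ∑ φ ∈ P, w φ - 1 := by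
    have : ∀ x, ∑ φ ∈ P.filter (fun φ => ¬ φ x = τ x - 1), t x φ
        = ∑ φ ∈ P, w φ * ((φ x : ℝ) / ((∑ y, φ y : ℕ) : ℝ)) := by
      intro x
      refine aux_move τ x (t x) (fun φ => w φ * ((φ x : ℝ) / ((∑ y, φ y : ℕ) : ℝ))) ?_ ?_
      · intro φ hφ
        exact aux_step υ φ x (hlt φ hφ)
      · intro φ h0
        simp [h0]
    rw [Finset.sum_congr rfl fun x _ => this x, Finset.sum_comm]
    have h0 : (0 : X → ℕ) ∈ P := by
      refine Fintype.mem_piFinset.2 fun y => Finset.mem_range.2 ?_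
      exact hτ y
    rw [← Finset.add_sum_erase P _ h0, ← Finset.add_sum_erase P w h0]
    have hw0 : w 0 = 1 := by simp [hw]
    rw [hw0, add_sub_cancel_left]
    have hz : ∑ x : X, (1 : ℝ) * (((0 : X → ℕ) x : ℝ) / ((∑ y, (0 : X → ℕ) y : ℕ) : ℝ)) = 0 := by
      simp
    rw [hz, zero_add]
    refine Finset.sum_congr rfl fun φ hφ => ?_
    rw [← Finset.mul_sum, ← Finset.sum_div, ← Nat.cast_sum, div_self, mul_one]
    have hne := Finset.ne_of_mem_erase hφ
    intro hs
    apply hne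
    have hs' : ∑ y, φ y = 0 := by exact_mod_cast hs
    funext y
    exact Finset.sum_eq_zero_iff.1 hs' y (Finset.mem_univ y)
  have h3 : ∑ x, ∑ φ ∈ P, t x φ = ∑ x, ∑ φ ∈ P.filter (fun φ => φ x = τ x - 1), t x φ
      + ∑ x, ∑ φ ∈ P.filter (fun φ => ¬ φ x = τ x - 1), t x φ := by
    rw [← Finset.sum_add_distrib]
    exact Finset.sum_congr rfl fun x _ => (Finset.sum_filter_add_sum_filter_not _ _ _).symm
  linarith
end

section
/- Let X be a nonempty finite set, let τ : X → ℕ satisfy τ(x) ≥ 1 for all x, and let υ : X → ℕ be an urn with υ(x) ≥ 1 for all x; write L = ∑_{x∈X} υ(x). Then the Pólya first-full probabilities sum to one: ∑_{x∈X} ∑_{φ} ((∏_{y∈X} MC(υ(y), φ(y))) / MC(L, ‖φ‖)) · ((υ(x) + φ(x)) / (L + ‖φ‖)) = 1 (as real numbers), where for each x the inner sum ranges over all φ : X → ℕ with φ(y) < τ(y) for every y ∈ X and φ(x) = τ(x) − 1, and ‖φ‖ = ∑_{y∈X} φ(y). -/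
/-- The multichoose coefficient `MC n m = C(n+m-1, m)`. -/
def MC (a b : ℕ) : ℕ := (a + b - 1).choose b

theorem MC_succ_aux (a b : ℕ) (ha : 1 ≤ a) :
    (MC a (b + 1) : ℝ) * ((b : ℝ) + 1) = MC a b * ((a : ℝ) + b) := by
  obtain ⟨c, rfl⟩ : ∃ c, a = c + 1 := ⟨a - 1, by omega⟩
  have h := Nat.add_one_mul_choose_eq (c + b) b
  have e1 : c + 1 + (b + 1) - 1 = c + b + 1 := by omega
  have e2 : c + 1 + b - 1 = c + b := by omega
  unfold MC
  rw [e1, e2]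
  have h' : (((c + b + 1) * (c + b).choose b : ℕ) : ℝ)
    = (((c + b + 1).choose (b + 1) * (b + 1) : ℕ) : ℝ) := by exact_mod_cast h
  push_cast at h' ⊢
  linarith

theorem MC_pos_aux (a b : ℕ) (ha : 1 ≤ a) : (0 : ℝ) < MC a b := by
  unfold MC
  exact_mod_cast Nat.choose_pos (by omega)

/-- the Pólya first-full probabilities sum to one. -/
theorem polya_firstFull_sum_eq_one
    (X : Type*) [Fintype X] [DecidableEq X] [Nonempty X]
    (τ υ : X → ℕ) (hτ : ∀ x, 1 ≤ τ x) (hυ : ∀ x, 1 ≤ υ x) :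
    ∑ x : X,
      ∑ φ ∈ (Fintype.piFinset fun y => Finset.range (τ y)).filter
          (fun φ => φ x = τ x - 1),
        ((∏ y, (MC (υ y) (φ y) : ℝ)) / (MC (∑ y, υ y) (∑ y, φ y) : ℝ)) *
          (((υ x : ℝ) + (φ x : ℝ)) / (((∑ y, υ y : ℕ) : ℝ) + ((∑ y, φ y : ℕ) : ℝ)))
      = 1 := by
  classical
  obtain ⟨x₀⟩ := ‹Nonempty X›
  have hL : 1 ≤ ∑ y, υ y :=
    (hυ x₀).trans (Finset.single_le_sum (f := υ) (fun _ _ => Nat.zero_le _) (Finset.mem_univ x₀))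
  set B := Fintype.piFinset fun y => Finset.range (τ y) with hB
  have memB : ∀ φ, φ ∈ B ↔ ∀ y, φ y < τ y := by intro φ; simp [hB]
  set L := ∑ y, υ y with hLdef
  let P : (X → ℕ) → ℝ := fun φ => (∏ y, (MC (υ y) (φ y) : ℝ)) / (MC L (∑ y, φ y) : ℝ)
  let w : X → (X → ℕ) → ℝ := fun x φ =>
    P φ * (((υ x : ℝ) + (φ x : ℝ)) / ((L : ℝ) + ((∑ y, φ y : ℕ) : ℝ)))
  change ∑ x, ∑ φ ∈ B.filter (fun φ => φ x = τ x - 1), w x φ = 1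
  have hLpos : (0 : ℝ) < L := by exact_mod_cast hL
  have hw1 : ∀ φ, ∑ x, w x φ = P φ := by
    intro φ
    simp only [w]
    rw [← Finset.mul_sum, ← Finset.sum_div, Finset.sum_add_distrib, ← Nat.cast_sum,
      ← Nat.cast_sum, ← hLdef, div_self, mul_one]
    positivity
  have hw2 : ∀ x φ, w x φ =
      P (φ + Pi.single x 1) * (((φ + Pi.single x 1 : X → ℕ) x : ℝ) /
        ((∑ y, (φ + Pi.single x 1 : X → ℕ) y : ℕ) : ℝ)) := by
    intro x φ
    have hs : ∑ y, (φ + Pi.single x 1 : X → ℕ) y = ∑ y, φ y + 1 := by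
      simp [Finset.sum_add_distrib]
    have hp : (∏ y, (MC (υ y) ((φ + Pi.single x 1 : X → ℕ) y) : ℝ)) * ((φ x : ℝ) + 1)
        = (∏ y, (MC (υ y) (φ y) : ℝ)) * ((υ x : ℝ) + φ x) := by
      rw [← Finset.mul_prod_erase _ _ (Finset.mem_univ x),
        ← Finset.mul_prod_erase _ (fun y => (MC (υ y) (φ y) : ℝ)) (Finset.mem_univ x)]
      have : ∏ y ∈ Finset.univ.erase x, (MC (υ y) ((φ + Pi.single x 1 : X → ℕ) y) : ℝ)
          = ∏ y ∈ Finset.univ.erase x, (MC (υ y) (φ y) : ℝ) := by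
        apply Finset.prod_congr rfl
        intro y hy
        simp [Pi.single_eq_of_ne (Finset.ne_of_mem_erase hy)]
      rw [this]
      have h := MC_succ_aux (υ x) (φ x) (hυ x)
      simp only [Pi.add_apply, Pi.single_eq_same]
      linear_combination (∏ y ∈ Finset.univ.erase x, (MC (υ y) (φ y) : ℝ)) * h
    have hm := MC_succ_aux L (∑ y, φ y) hL
    have p1 := MC_pos_aux L (∑ y, φ y) hL
    have p2 := MC_pos_aux L (∑ y, φ y + 1) hL
    simp only [w, P]
    rw [hs, div_mul_div_comm, div_mul_div_comm, ← hm]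
    simp only [Pi.add_apply, Pi.single_eq_same] at hp ⊢
    push_cast at hp ⊢
    rw [hp]
  have hP0 : P 0 = 1 := by simp [P, MC]
  have h0B : (0 : X → ℕ) ∈ B := (memB 0).2 fun y => hτ y
  have key : ∀ x, ∑ φ ∈ B.filter (fun φ => ¬ φ x = τ x - 1), w x φ
      = ∑ ψ ∈ B, P ψ * ((ψ x : ℝ) / ((∑ y, ψ y : ℕ) : ℝ)) := by
    intro x
    rw [← Finset.sum_filter_of_ne (s := B) (p := fun ψ => ψ x ≠ 0)
      (by intro ψ _ h h0; simp [h0] at h)]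
    refine Finset.sum_nbij' (fun φ => φ + Pi.single x 1) (fun ψ => ψ - Pi.single x 1)
      ?_ ?_ ?_ ?_ ?_
    · intro φ h
      simp only [Finset.mem_filter, memB] at h ⊢
      refine ⟨fun y => ?_, by simp⟩
      have := h.1 y
      by_cases hy : y = x
      · subst hy; simp; omega
      · simpa [hy] using this
    · intro φ h
      simp only [Finset.mem_filter, memB] at h ⊢
      have := h.1 x
      refine ⟨fun y => ?_, by simp; omega⟩
      have := h.1 y
      simp only [Pi.sub_apply]
      omega
    · intro φ _
      simp
    · intro φ h
      simp only [Finset.mem_filter] at h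
      ext y
      by_cases hy : y = x
      · subst hy; simp; omega
      · simp [hy]
    · intro φ _
      exact hw2 x φ
  have h1 : ∑ x, ∑ φ ∈ B, w x φ = ∑ φ ∈ B, P φ := by
    rw [Finset.sum_comm]
    exact Finset.sum_congr rfl fun φ _ => hw1 φ
  have h2 : ∑ x, ∑ ψ ∈ B, P ψ * ((ψ x : ℝ) / ((∑ y, ψ y : ℕ) : ℝ)) = ∑ φ ∈ B.erase 0, P φ := by
    rw [Finset.sum_comm, ← Finset.add_sum_erase _ _ h0B]
    simp only [Pi.zero_apply, Nat.cast_zero, zero_div, mul_zero, Finset.sum_const_zero, zero_add]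
    refine Finset.sum_congr rfl fun ψ hψ => ?_
    rw [← Finset.mul_sum, ← Finset.sum_div, ← Nat.cast_sum, div_self, mul_one]
    intro h
    apply Finset.ne_of_mem_erase hψ
    ext y
    have h' : ∑ y, ψ y = 0 := by exact_mod_cast h
    exact (Finset.sum_eq_zero_iff.1 h') y (Finset.mem_univ y)
  have h3 : ∑ x, ∑ φ ∈ B, w x φ = ∑ x, ∑ φ ∈ B.filter (fun φ => φ x = τ x - 1), w x φ
      + ∑ x, ∑ φ ∈ B.filter (fun φ => ¬ φ x = τ x - 1), w x φ := by
    rw [← Finset.sum_add_distrib]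
    exact Finset.sum_congr rfl fun x _ => (Finset.sum_filter_add_sum_filter_not _ _ _).symm
  rw [Finset.sum_congr rfl fun x _ => key x, h2, h1, ← Finset.add_sum_erase _ _ h0B, hP0] at h3
  linarith
end

section
/- Let X be a finite set with a distinguished element y ∈ X, let ω : X → ℝ be a probability distribution (∑_{x∈X} ω(x) = 1, ω(x) ≥ 0) with 0 < ω(y) < 1, and let m ≥ 1 and k ≥ 0 be natural numbers. Then the negative multinomial probability for the single tube m·|y⟩ at m+k equals the negative binomial probability: ∑_{φ} (‖φ‖!/∏_{x∈X} φ(x)!) · (∏_{x∈X} ω(x)^{φ(x)}) · ω(y) = MC(m,k) · ω(y)^m · (1−ω(y))^k, where the sum ranges over all φ : X → ℕ with ∑_{x∈X} φ(x) = m+k−1 and φ(y) = m−1, and MC(m,k) = C(m+k−1, k). -/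
/-- the negative multinomial probability for a single tube `m·|y⟩`
at `m + k` equals the negative binomial probability. -/
theorem negative_multinomial_single_tube
    (X : Type*) [Fintype X] [DecidableEq X] (y : X)
    (ω : X → ℝ) (hnn : ∀ x, 0 ≤ ω x) (hsum : ∑ x, ω x = 1)
    (hy0 : 0 < ω y) (hy1 : ω y < 1)
    (m k : ℕ) (hm : 1 ≤ m) :
    ∑ φ ∈ (Fintype.piFinset fun _ : X => Finset.range (m + k)).filter
        (fun φ => ∑ x, φ x = m + k - 1 ∧ φ y = m - 1),
      (((∑ x, φ x).factorial : ℝ) / ∏ x, ((φ x).factorial : ℝ)) *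
        (∏ x, ω x ^ φ x) * ω y
      = (MC m k : ℝ) * ω y ^ m * (1 - ω y) ^ k := by
  obtain ⟨a, rfl⟩ : ∃ a, m = a + 1 := ⟨m - 1, by omega⟩
  have e1 : a + 1 + k - 1 = a + k := by omega
  have hω : 1 - ω y = ∑ x ∈ Finset.univ.erase y, ω x := by
    rw [← hsum, ← Finset.add_sum_erase _ _ (Finset.mem_univ y)]; ring
  rw [hω, Finset.sum_pow_eq_sum_piAntidiag, Finset.mul_sum]
  simp only [MC, e1, Nat.add_sub_cancel]
  have hs : ∀ φ : X → ℕ, ∑ x, φ x = φ y + ∑ x ∈ Finset.univ.erase y, φ x :=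
    fun φ => (Finset.add_sum_erase _ _ (Finset.mem_univ y)).symm
  have hu : ∀ (φ : X → ℕ) (c : ℕ), ∀ x ∈ Finset.univ.erase y, Function.update φ y c x = φ x := by
    intro φ c x hx
    exact Function.update_of_ne (Finset.ne_of_mem_erase hx) _ _
  refine Finset.sum_bij' (fun φ _ => Function.update φ y 0) (fun ψ _ => Function.update ψ y a)
    ?_ ?_ ?_ ?_ ?_
  · intro φ hφ
    obtain ⟨-, h1, h2⟩ := Finset.mem_filter.1 hφ
    rw [Finset.mem_piAntidiag, Finset.sum_congr rfl (hu φ 0)]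
    refine ⟨by change ∑ x ∈ Finset.univ.erase y, φ x = k; have := hs φ; omega, fun i hi => ?_⟩
    refine Finset.mem_erase.2 ⟨?_, Finset.mem_univ _⟩
    rintro rfl
    simp at hi
  · intro ψ hψ
    obtain ⟨h1, h2⟩ := Finset.mem_piAntidiag.1 hψ
    have h3 : ∑ x, Function.update ψ y a x = a + k := by
      rw [hs, Finset.sum_congr rfl (hu ψ a), Function.update_self, h1]
    refine Finset.mem_filter.2 ⟨?_, h3, Function.update_self ..⟩
    refine Fintype.mem_piFinset.2 fun x => Finset.mem_range.2 ?_
    have := Finset.single_le_sum (f := Function.update ψ y a) (fun _ _ => Nat.zero_le _)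
      (Finset.mem_univ x)
    omega
  · intro φ hφ
    obtain ⟨-, h1, h2⟩ := Finset.mem_filter.1 hφ
    simp [← h2]
  · intro ψ hψ
    obtain ⟨h1, h2⟩ := Finset.mem_piAntidiag.1 hψ
    have : ψ y = 0 := by
      by_contra h
      exact Finset.notMem_erase _ _ (h2 y h)
    simp [← this]
  · intro φ hφ
    obtain ⟨-, h1, h2⟩ := Finset.mem_filter.1 hφ
    have h3 : ∑ x ∈ Finset.univ.erase y, φ x = k := by have := hs φ; omega
    have h4 : ∏ x ∈ Finset.univ.erase y, ω x ^ (Function.update φ y 0 x)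
        = ∏ x ∈ Finset.univ.erase y, ω x ^ φ x :=
      Finset.prod_congr rfl fun x hx => by rw [hu φ 0 x hx]
    have h5 := Nat.multinomial_spec Finset.univ φ
    have h6 := Nat.multinomial_insert (Finset.notMem_erase y Finset.univ) φ
    rw [Finset.insert_erase (Finset.mem_univ y), h2, h3, Nat.choose_symm_add] at h6
    rw [h6] at h5
    rw [h4, Nat.multinomial_congr (hu φ 0), ← h5,
      ← Finset.mul_prod_erase _ (fun x => ω x ^ φ x) (Finset.mem_univ y), h2]
    have h7 : (∏ x, ((φ x).factorial : ℝ)) ≠ 0 :=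
      Finset.prod_ne_zero_iff.2 fun x _ => by positivity
    push_cast
    rw [mul_div_cancel_left₀ _ h7]
    ring
end

section
/- Let X be a finite set with a distinguished element y ∈ X, let υ : X → ℕ be an urn with total size L = ∑_{x∈X} υ(x), and let m ≥ 1, k ≥ 0 with υ(y) ≥ m and m + k ≤ L. Then the negative hypergeometric probability for the single tube m·|y⟩ at m+k satisfies, as real numbers: ∑_{φ} ((∏_{x∈X} C(υ(x), φ(x))) / C(L, m+k−1)) · ((υ(y) − φ(y)) / (L − (m+k−1))) = (m/(m+k)) · (C(υ(y), m) · C(L−υ(y), k)) / C(L, m+k), where the sum ranges over all φ : X → ℕ with φ ≤ υ pointwise, ∑_{x∈X} φ(x) = m+k−1 and φ(y) = m−1. -/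
open Polynomial in
theorem vandermonde_aux
    (X : Type*) [Fintype X] [DecidableEq X] (y : X) (υ : X → ℕ) (a k : ℕ)
    (hy : a ≤ υ y) :
    ∑ φ ∈ (Fintype.piFinset fun x : X => Finset.range (υ x + 1)).filter
        (fun φ => ∑ x, φ x = a + k ∧ φ y = a), ∏ x, (υ x).choose (φ x)
      = (υ y).choose a * ((∑ x, υ x) - υ y).choose k := by
  have h := Finset.prod_univ_sum (fun x : X => Finset.range (υ x + 1))
    (fun x j => (if x = y ∧ j ≠ a then 0 else
      ((υ x).choose j : ℕ[X]) * Polynomial.X ^ j))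
  have hL : (∏ x, ∑ j ∈ Finset.range (υ x + 1), (if x = y ∧ j ≠ a then 0 else
      ((υ x).choose j : ℕ[X]) * Polynomial.X ^ j))
      = ((υ y).choose a : ℕ[X]) * (Polynomial.X ^ a *
        (Polynomial.X + 1) ^ ((∑ x, υ x) - υ y)) := by
    rw [← Finset.mul_prod_erase _ _ (Finset.mem_univ y), ← mul_assoc]
    congr 1
    · rw [Finset.sum_eq_single a]
      · simp
      · intro b _ hb; simp [hb]
      · intro ha; exact absurd (Finset.mem_range.2 (by omega)) ha
    · have e : (∑ x, υ x) - υ y = ∑ x ∈ Finset.univ.erase y, υ x := by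
        rw [← Finset.add_sum_erase _ _ (Finset.mem_univ y)]; omega
      rw [e, ← Finset.prod_pow_eq_pow_sum]
      refine Finset.prod_congr rfl fun x hx => ?_
      have hxy : x ≠ y := Finset.ne_of_mem_erase hx
      rw [add_pow]
      refine Finset.sum_congr rfl fun j _ => ?_
      simp [hxy, mul_comm]
  rw [hL] at h
  have h2 := congrArg (fun p => Polynomial.coeff p (a + k)) h
  simp only [Polynomial.finsetSum_coeff] at h2
  rw [← Polynomial.C_eq_natCast, Polynomial.coeff_C_mul, add_comm a k,
    Polynomial.coeff_X_pow_mul, Polynomial.coeff_X_add_one_pow] at h2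
  simp only [Nat.cast_id] at h2
  rw [h2, Finset.sum_filter]
  refine Finset.sum_congr rfl fun φ _ => ?_
  by_cases hφ : φ y = a
  · have : ∏ x, (if x = y ∧ φ x ≠ a then 0 else
      ((υ x).choose (φ x) : ℕ[X]) * Polynomial.X ^ (φ x))
      = Polynomial.C (∏ x, (υ x).choose (φ x)) * Polynomial.X ^ (∑ x, φ x) := by
      rw [map_prod, ← Finset.prod_pow_eq_pow_sum, ← Finset.prod_mul_distrib]
      refine Finset.prod_congr rfl fun x _ => ?_
      rw [if_neg (by rintro ⟨h5, h6⟩; subst h5; exact h6 hφ)]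
      simp
    rw [this, Polynomial.coeff_C_mul, Polynomial.coeff_X_pow]
    simp [hφ, add_comm a k, eq_comm]
  · rw [if_neg (by tauto), Finset.prod_eq_zero (Finset.mem_univ y)]
    · simp
    · simp [hφ]


/-- the negative hypergeometric probability for a single tube `m·|y⟩`
at `m + k`, expressed via the bivariate hypergeometric distribution. -/
theorem negative_hypergeometric_single_tube
    (X : Type*) [Fintype X] [DecidableEq X] (y : X)
    (υ : X → ℕ) (m k : ℕ) (hm : 1 ≤ m)
    (hy : m ≤ υ y) (hL : m + k ≤ ∑ x, υ x) :
    ∑ φ ∈ (Fintype.piFinset fun x : X => Finset.range (υ x + 1)).filter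
        (fun φ => ∑ x, φ x = m + k - 1 ∧ φ y = m - 1),
      ((∏ x, ((υ x).choose (φ x) : ℝ)) / ((∑ x, υ x).choose (m + k - 1) : ℝ)) *
        (((υ y : ℝ) - (φ y : ℝ)) / (((∑ x, υ x : ℕ) : ℝ) - ((m + k - 1 : ℕ) : ℝ)))
      = ((m : ℝ) / ((m : ℝ) + (k : ℝ))) *
          (((υ y).choose m : ℝ) * (((∑ x, υ x) - υ y).choose k : ℝ)) /
            ((∑ x, υ x).choose (m + k) : ℝ) := by
  obtain ⟨a, rfl⟩ : ∃ a, m = a + 1 := ⟨m - 1, by omega⟩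
  have e1 : a + 1 + k - 1 = a + k := by omega
  rw [e1, Nat.add_sub_cancel]
  have hv := vandermonde_aux X y υ a k (by omega)
  have hv' := congrArg (Nat.cast (R := ℝ)) hv
  simp only [Nat.cast_sum, Nat.cast_prod, Nat.cast_mul] at hv'
  set L := ∑ x, υ x with hLdef
  rw [Finset.sum_congr rfl (g := fun φ => (∏ x, ((υ x).choose (φ x) : ℝ)) *
    (((L.choose (a + k) : ℝ))⁻¹ * (((υ y : ℝ) - a) / ((L : ℝ) - ((a + k : ℕ) : ℝ)))))
    (fun φ hφ => by
      rw [(Finset.mem_filter.1 hφ).2.2, div_eq_mul_inv, mul_assoc]), ← Finset.sum_mul]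
  rw [hv']
  have c1 := congrArg (Nat.cast (R := ℝ)) (Nat.choose_succ_right_eq (υ y) a)
  have c2 := congrArg (Nat.cast (R := ℝ)) (Nat.choose_succ_right_eq L (a + k))
  rw [Nat.cast_mul, Nat.cast_mul, Nat.cast_sub (by omega)] at c1 c2
  have p1 : (0 : ℝ) < L.choose (a + k) := by exact_mod_cast Nat.choose_pos (by omega)
  have p2 : (0 : ℝ) < L.choose (a + k + 1) := by exact_mod_cast Nat.choose_pos (by omega)
  have p3 : (0 : ℝ) < (L : ℝ) - ((a + k : ℕ) : ℝ) := by
    rw [sub_pos]; exact_mod_cast (by omega)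
  have p4 : ((a + 1 : ℕ) : ℝ) + k = ((a + k + 1 : ℕ) : ℝ) := by push_cast; ring
  have p5 : (0 : ℝ) < ((a + k + 1 : ℕ) : ℝ) := by positivity
  rw [p4, show a + 1 + k = a + k + 1 by omega]
  generalize (L : ℝ) - ((a + k : ℕ) : ℝ) = D at *
  generalize ((a + k + 1 : ℕ) : ℝ) = N at *
  generalize (υ y : ℝ) - a = E at *
  generalize ((a + 1 : ℕ) : ℝ) = M at *
  generalize (L.choose (a + k) : ℝ) = A at *
  generalize (L.choose (a + k + 1) : ℝ) = B at *
  generalize ((υ y).choose (a + 1) : ℝ) = F at *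
  generalize ((υ y).choose a : ℝ) = G at *
  generalize ((L - υ y).choose k : ℝ) = H at *
  field_simp
  linear_combination (-H * B * N) * c1 + (M * F * H) * c2
end

section
/- Let X be a finite set with a distinguished element y ∈ X, let υ : X → ℕ be an urn with υ(y) ≥ 1 and total size L = ∑_{x∈X} υ(x) ≥ 1, and let m ≥ 1, k ≥ 0. Then the negative Pólya probability for the single tube m·|y⟩ at m+k satisfies, as real numbers: ∑_{φ} ((∏_{x∈X} MC(υ(x), φ(x))) / MC(L, m+k−1)) · ((υ(y) + φ(y)) / (L + (m+k−1))) = (m/(m+k)) · (MC(υ(y), m) · MC(L−υ(y), k)) / MC(L, m+k), where the sum ranges over all φ : X → ℕ with ∑_{x∈X} φ(x) = m+k−1, φ(y) = m−1, and φ(x) = 0 whenever υ(x) = 0. -/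
theorem MC_eq (a b : ℕ) : MC a b = Nat.multichoose a b := (Nat.multichoose_eq a b).symm

noncomputable def FF (n : ℕ) : PowerSeries ℝ := PowerSeries.mk fun j => (MC n j : ℝ)

theorem FF_zero : FF 0 = 1 := by
  ext j
  rw [FF, PowerSeries.coeff_mk, PowerSeries.coeff_one, MC_eq]
  cases j <;> simp

theorem FF_succ (n : ℕ) : FF (n + 1) = FF n + PowerSeries.X * FF (n + 1) := by
  ext j
  cases j with
  | zero => simp [FF, MC_eq]
  | succ j =>
    rw [map_add, PowerSeries.coeff_succ_X_mul]
    simp only [FF, PowerSeries.coeff_mk, MC_eq, Nat.multichoose_succ_succ]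
    push_cast
    ring

theorem FF_mul (n : ℕ) : (1 - PowerSeries.X) ^ n * FF n = 1 := by
  induction n with
  | zero => simp [FF_zero]
  | succ n ih =>
    have h : (1 - PowerSeries.X) * FF (n + 1) = FF n := by
      linear_combination FF_succ n
    rw [pow_succ, mul_assoc, h, ih]

theorem FF_add (a b : ℕ) : FF (a + b) = FF a * FF b := by
  have h := FF_mul (a + b)
  have ha := FF_mul a
  have hb := FF_mul b
  rw [pow_add] at h
  linear_combination (FF a * FF b) * h - FF (a + b) * (1 - PowerSeries.X) ^ b * FF b * ha
    - FF (a + b) * hb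

theorem FF_prod {X : Type*} (s : Finset X) (v : X → ℕ) :
    ∏ x ∈ s, FF (v x) = FF (∑ x ∈ s, v x) := by
  classical
  induction s using Finset.induction_on with
  | empty => simp [FF_zero]
  | insert a s ha ih => rw [Finset.prod_insert ha, Finset.sum_insert ha, ih, FF_add]

theorem MC_step (n j : ℕ) (hn : 1 ≤ n) :
    (MC n j : ℝ) * ((n : ℝ) + j) = (j + 1) * (MC n (j + 1) : ℝ) := by
  obtain ⟨n, rfl⟩ := Nat.exists_eq_add_of_le' hn
  have h := Nat.add_one_mul_choose_eq (n + j) j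
  have e1 : MC (n + 1) j = (n + j).choose j := by unfold MC; congr 1; omega
  have e2 : MC (n + 1) (j + 1) = (n + j + 1).choose (j + 1) := by unfold MC; congr 1; omega
  rw [e1, e2]
  have h' : ((n : ℝ) + j + 1) * ((n + j).choose j : ℝ) = ((n + j + 1).choose (j + 1) : ℝ) * (j + 1) := by
    exact_mod_cast h
  push_cast
  linear_combination h'

theorem MC_pos (n j : ℕ) (hn : 1 ≤ n) : (0 : ℝ) < MC n j := by
  have : 0 < MC n j := Nat.choose_pos (by omega)
  exact_mod_cast this

theorem key_sum {X : Type*} [Fintype X] [DecidableEq X] (y : X) (υ : X → ℕ) (j k : ℕ) :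
    ∑ φ ∈ (Fintype.piFinset fun _ : X => Finset.range (j + 1 + k)).filter
        (fun φ => ∑ x, φ x = j + k ∧ φ y = j ∧ ∀ x, υ x = 0 → φ x = 0),
      ∏ x, (MC (υ x) (φ x) : ℝ) = MC (υ y) j * MC ((∑ x, υ x) - υ y) k := by
  classical
  set g : X → PowerSeries ℝ :=
    fun x => if x = y then PowerSeries.monomial j (MC (υ y) j : ℝ) else FF (υ x) with hg
  have hs : (∑ x, υ x) - υ y = ∑ x ∈ Finset.univ.erase y, υ x := by
    rw [← Finset.add_sum_erase _ _ (Finset.mem_univ y)]; simp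
  have h1 : PowerSeries.coeff (j + k) (∏ x, g x) = MC (υ y) j * MC ((∑ x, υ x) - υ y) k := by
    rw [← Finset.mul_prod_erase _ _ (Finset.mem_univ y)]
    have : ∏ x ∈ Finset.univ.erase y, g x = ∏ x ∈ Finset.univ.erase y, FF (υ x) :=
      Finset.prod_congr rfl fun x hx => by simp [hg, Finset.ne_of_mem_erase hx]
    rw [this, FF_prod, hs]
    simp only [hg, if_true]
    have hmon : PowerSeries.monomial j (MC (υ y) j : ℝ)
        = PowerSeries.C (MC (υ y) j : ℝ) * PowerSeries.X ^ j := by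
      ext i
      rw [PowerSeries.coeff_monomial, PowerSeries.coeff_C_mul_X_pow]
    rw [hmon, mul_assoc, PowerSeries.coeff_C_mul, add_comm j k,
      PowerSeries.coeff_X_pow_mul, FF, PowerSeries.coeff_mk]
  rw [← h1, PowerSeries.coeff_prod]
  refine Finset.sum_bij_ne_zero (fun φ _ _ => Finsupp.equivFunOnFinite.symm φ) ?_ ?_ ?_ ?_
  · intro φ hφ _
    simp only [Finset.mem_filter] at hφ
    simp [Finset.mem_finsuppAntidiag, hφ.2.1]
  · intro a _ _ b _ _ h
    exact Finsupp.equivFunOnFinite.symm.injective h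
  · intro f hf hne
    have hsum : ∑ x, f x = j + k := by
      simpa [Finset.mem_finsuppAntidiag] using hf
    have hne' := fun x => Finset.prod_ne_zero_iff.1 hne x (Finset.mem_univ x)
    have hfy : f y = j := by
      by_contra hc
      apply hne' y
      simp [hg, PowerSeries.coeff_monomial, hc]
    have hz : ∀ x, (MC (υ x) (f x) : ℝ) ≠ 0 := by
      intro x
      have := hne' x
      by_cases hx : x = y
      · subst hx
        simpa [hg, hfy, PowerSeries.coeff_monomial] using this
      · simpa [hg, hx, FF] using this
    refine ⟨f, ?_, ?_, ?_⟩
    · simp only [Finset.mem_filter, Fintype.mem_piFinset, Finset.mem_range]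
      refine ⟨fun x => ?_, hsum, hfy, fun x hx => ?_⟩
      · have := Finset.single_le_sum (f := fun x => f x) (fun i _ => Nat.zero_le _) (Finset.mem_univ x)
        omega
      · by_contra hc
        obtain ⟨c, hc'⟩ := Nat.exists_eq_succ_of_ne_zero hc
        apply hz x
        rw [hx, hc', MC_eq]
        simp
    · exact Finset.prod_ne_zero_iff.2 fun x _ => hz x
    · ext x; simp
  · intro φ hφ _
    simp only [Finset.mem_filter] at hφ
    refine Finset.prod_congr rfl fun x _ => ?_
    by_cases hx : x = y
    · subst hx
      simp [hg, hφ.2.2.1, PowerSeries.coeff_monomial]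
    · simp [hg, hx, FF]



/-- the negative Pólya probability for a single tube `m·|y⟩`
at `m + k`, expressed via the bivariate Pólya distribution. -/
theorem negative_polya_single_tube
    (X : Type*) [Fintype X] [DecidableEq X] (y : X)
    (υ : X → ℕ) (hy : 1 ≤ υ y) (hL : 1 ≤ ∑ x, υ x)
    (m k : ℕ) (hm : 1 ≤ m) :
    ∑ φ ∈ (Fintype.piFinset fun _ : X => Finset.range (m + k)).filter
        (fun φ => ∑ x, φ x = m + k - 1 ∧ φ y = m - 1 ∧ ∀ x, υ x = 0 → φ x = 0),
      ((∏ x, (MC (υ x) (φ x) : ℝ)) / (MC (∑ x, υ x) (m + k - 1) : ℝ)) *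
        (((υ y : ℝ) + (φ y : ℝ)) / (((∑ x, υ x : ℕ) : ℝ) + ((m + k - 1 : ℕ) : ℝ)))
      = ((m : ℝ) / ((m : ℝ) + (k : ℝ))) *
          ((MC (υ y) m : ℝ) * (MC ((∑ x, υ x) - υ y) k : ℝ)) /
            (MC (∑ x, υ x) (m + k) : ℝ) := by
  obtain ⟨j, rfl⟩ := Nat.exists_eq_add_of_le' hm
  have e : j + 1 + k - 1 = j + k := by omega
  have e2 : j + 1 + k = j + k + 1 := by omega
  have key := key_sum y υ j k
  simp only [e, Nat.add_sub_cancel]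
  generalize hLL : ∑ x, υ x = L at *
  have s1 := MC_step (υ y) j hy
  have s2 := MC_step L (j + k) hL
  have p1 := MC_pos L (j + k) hL
  have p2 := MC_pos L (j + k + 1) hL
  have hLp : (0 : ℝ) < L := by exact_mod_cast hL
  rw [Finset.sum_congr rfl (g := fun φ : X → ℕ => (∏ x, (MC (υ x) (φ x) : ℝ)) *
    (((υ y : ℝ) + j) / ((MC L (j + k) : ℝ) * ((L : ℝ) + ((j + k : ℕ) : ℝ)))))]
  · rw [← Finset.sum_mul, key, s2, e2]
    have hp : (0 : ℝ) < (j : ℝ) + k + 1 := by positivity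
    have hp' : (0 : ℝ) < (j : ℝ) + 1 + k := by positivity
    push_cast
    field_simp
    linear_combination ((j : ℝ) + 1 + k) * (MC (L - υ y) k : ℝ) * s1
  · intro φ hφ
    simp only [Finset.mem_filter] at hφ
    rw [hφ.2.2.1, div_mul_div_comm, mul_div_assoc]
end

section
/- Let n ≥ 1 and m ≥ 1 be natural numbers and let r, s ∈ ℝ with r, s ∈ [0,1] and r + s = 1. Then r^n · ∑_{j=0}^{m−1} MC(n,j) · s^j + s^m · ∑_{i=0}^{n−1} MC(m,i) · r^i = 1, where MC(a,b) = C(a+b−1, b) and C denotes the binomial coefficient. -/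
lemma step_aux (r s : ℝ) (hrs : r + s = 1) (n M : ℕ) :
    r * (∑ j ∈ Finset.range (M+1), ((n+1+j).choose j : ℝ) * s ^ j)
      = (∑ j ∈ Finset.range (M+1), ((n+j).choose j : ℝ) * s ^ j)
        - ((n+1+M).choose M : ℝ) * s ^ (M+1) := by
  obtain rfl : r = 1 - s := by linarith
  induction M with
  | zero => simp
  | succ M ih =>
    rw [Finset.sum_range_succ, mul_add, ih, Finset.sum_range_succ _ (M+1)]
    have h : (n+1+(M+1)).choose (M+1) = (n+1+M).choose M + (n+(M+1)).choose (M+1) := by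
      rw [show n+1+(M+1) = (n+1+M)+1 by ring, Nat.choose_succ_succ,
        show n+(M+1) = n+1+M by ring]
    rw [h]
    push_cast
    ring

lemma main_aux (r s : ℝ) (hrs : r + s = 1) (n M : ℕ) :
    r ^ (n+1) * (∑ j ∈ Finset.range (M+1), ((n+j).choose j : ℝ) * s ^ j) +
      s ^ (M+1) * (∑ i ∈ Finset.range (n+1), ((M+i).choose i : ℝ) * r ^ i) = 1 := by
  induction n with
  | zero =>
    have h := mul_neg_geom_sum s (M+1)
    have hr : r = 1 - s := by linarith
    simp [hr, h]
  | succ n ih =>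
    rw [pow_succ, mul_assoc, step_aux r s hrs, Finset.sum_range_succ _ (n+1)]
    have h : (n+1+M).choose M = (M+(n+1)).choose (n+1) := by
      rw [add_comm (n+1) M]
      exact Nat.choose_symm_add
    rw [h]
    linear_combination ih

/-- bivariate multinomial first-full probabilities add up to one. -/
theorem bivariate_multinomial_firstFull
    (n m : ℕ) (hn : 1 ≤ n) (hm : 1 ≤ m)
    (r s : ℝ) (hr0 : 0 ≤ r) (hr1 : r ≤ 1) (hs0 : 0 ≤ s) (hs1 : s ≤ 1)
    (hrs : r + s = 1) :
    r ^ n * (∑ j ∈ Finset.range m, (MC n j : ℝ) * s ^ j) +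
      s ^ m * (∑ i ∈ Finset.range n, (MC m i : ℝ) * r ^ i) = 1 := by
  obtain ⟨n, rfl⟩ := Nat.exists_eq_add_of_le' hn
  obtain ⟨m, rfl⟩ := Nat.exists_eq_add_of_le' hm
  have h : ∀ a b : ℕ, MC (a+1) b = (a+b).choose b := by
    intro a b
    rw [MC, show a + 1 + b - 1 = a + b by omega]
  simp only [h]
  exact main_aux r s hrs n m
end

section
/- Let n, m, N, M be natural numbers with 1 ≤ n ≤ N and 1 ≤ m ≤ M. Then ∑_{j=0}^{m−1} MC(n,j) · C(N−n+M−j, N−n) + ∑_{i=0}^{n−1} MC(m,i) · C(N−i+M−m, M−m) = C(N+M, N), where MC(a,b) = C(a+b−1, b) and C denotes the binomial coefficient. -/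
def auxA (a b n m : ℕ) : ℕ :=
  ∑ j ∈ Finset.range m, Nat.multichoose n j * (a + (m + b) - j).choose a

lemma auxA_zero_right (a b n : ℕ) : auxA a b n 0 = 0 := by simp [auxA]

lemma auxA_zero_left (a b m : ℕ) : auxA a b 0 (m + 1) = (a + (m + 1 + b)).choose a := by
  simp [auxA, Finset.sum_range_succ']

lemma auxA_succ (a b n m : ℕ) :
    auxA a b (n + 1) (m + 1) = auxA a b n (m + 1) + auxA a b (n + 1) m := by
  unfold auxA
  rw [Finset.sum_range_succ', Finset.sum_range_succ' _ m]
  have h : ∀ j, a + (m + 1 + b) - (j + 1) = a + (m + b) - j := by intro j; omega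
  simp only [h, Nat.multichoose_succ_succ, add_mul, Finset.sum_add_distrib,
    Nat.multichoose_zero_right]
  ring

lemma aux_main (a b n m : ℕ) (h : 0 < n + m) :
    auxA a b n m + auxA b a m n = (n + a + (m + b)).choose (n + a) := by
  induction n generalizing m with
  | zero =>
    obtain ⟨m, rfl⟩ : ∃ k, m = k + 1 := ⟨m - 1, by omega⟩
    rw [auxA_zero_left, auxA_zero_right]
    simp
  | succ n ihn =>
    induction m with
    | zero =>
      rw [auxA_zero_left, auxA_zero_right, zero_add, zero_add,
        Nat.add_comm (n + 1 + a) b, Nat.choose_symm_add]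
    | succ m ihm =>
      have h1 := ihn (m + 1) (by omega)
      have h2 := ihm (by omega)
      rw [auxA_succ, auxA_succ b a]
      have e : n + 1 + a + (m + 1 + b) = (n + a + (m + 1 + b)) + 1 := by ring
      have e2 : n + 1 + a = n + a + 1 := by ring
      have e3 : n + 1 + a + (m + b) = n + a + (m + 1 + b) := by ring
      rw [e3, e2] at h2
      rw [e, e2, Nat.choose_succ_succ', ← h1, ← h2]
      ring

/-- bivariate hypergeometric first-full probabilities add up to one. -/
theorem bivariate_hypergeometric_firstFull
    (n m N M : ℕ) (hn : 1 ≤ n) (hnN : n ≤ N) (hm : 1 ≤ m) (hmM : m ≤ M) :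
    (∑ j ∈ Finset.range m, MC n j * (N - n + M - j).choose (N - n)) +
      (∑ i ∈ Finset.range n, MC m i * (N - i + M - m).choose (M - m)) =
      (N + M).choose N := by
  obtain ⟨a, rfl⟩ := Nat.exists_eq_add_of_le hnN
  obtain ⟨b, rfl⟩ := Nat.exists_eq_add_of_le hmM
  rw [← aux_main a b n m (by omega)]
  unfold auxA
  congr 1
  · refine Finset.sum_congr rfl fun j _ => ?_
    rw [MC, Nat.multichoose_eq, Nat.add_sub_cancel_left]
  · refine Finset.sum_congr rfl fun i hi => ?_
    have := Finset.mem_range.mp hi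
    rw [MC, Nat.multichoose_eq, Nat.add_sub_cancel_left]
    congr 2
    omega
end

section
/- Let n ≥ 1 and m ≥ 1 be natural numbers and let r, s ∈ ℝ with 0 < r < 1 and s = 1 − r. Then the series ∑_{i=0}^{∞} (MC(n, m+i) · s^i + MC(m, n+i) · r^i) converges and equals 1/(r^n · s^m), where MC(a,b) = C(a+b−1, b) and C denotes the binomial coefficient. -/
theorem aux_base (m : ℕ) (r s : ℝ) (hr0 : 0 < r) (hr1 : r < 1) (hs : s = 1 - r) :
    HasSum (fun i : ℕ => (Nat.multichoose (m + 1) i : ℝ) * r ^ i) (1 / s ^ (m + 1)) := by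
  have h := hasSum_choose_mul_geometric_of_norm_lt_one m (r := r)
    (by rw [Real.norm_eq_abs, abs_of_pos hr0]; exact hr1)
  rw [hs]
  have e : (fun i : ℕ => (Nat.multichoose (m + 1) i : ℝ) * r ^ i)
      = fun i : ℕ => ((i + m).choose m : ℝ) * r ^ i := by
    funext i
    rw [Nat.multichoose_eq, show m + 1 + i - 1 = i + m by omega, Nat.choose_symm_add]
  rw [e]
  exact h

theorem aux_main_s11 (r s : ℝ) (hr0 : 0 < r) (hr1 : r < 1) (hs : s = 1 - r) (n : ℕ) :
    ∀ m : ℕ, 1 ≤ n + m →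
    HasSum (fun i : ℕ => (Nat.multichoose n (m + i) : ℝ) * s ^ i
      + (Nat.multichoose m (n + i) : ℝ) * r ^ i) (1 / (r ^ n * s ^ m)) := by
  have hs0 : 0 < s := by linarith
  induction n with
  | zero =>
    intro m hm
    obtain ⟨k, rfl⟩ : ∃ k, m = k + 1 := ⟨m - 1, by omega⟩
    have h := aux_base k r s hr0 hr1 hs
    convert h using 1
    · funext i
      rw [show k + 1 + i = (k + i) + 1 by omega, Nat.multichoose_zero_succ]
      simp
    · simp
  | succ n ihn =>
    intro m
    induction m with
    | zero =>
      intro _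
      have h := aux_base n s r hs0 (by linarith) (by linarith)
      convert h using 1
      · funext i
        rw [show n + 1 + i = (n + i) + 1 by omega, Nat.multichoose_zero_succ]
        simp
      · simp
    | succ m ihm =>
      intro _
      have h := (ihn (m + 1) (by omega)).add (ihm (by omega))
      convert h using 1
      · funext i
        rw [show m + 1 + i = (m + i) + 1 by omega, show n + 1 + i = (n + i) + 1 by omega,
          Nat.multichoose_succ_succ, Nat.multichoose_succ_succ]
        push_cast
        ring
      · field_simp
        rw [hs]; ring

/-- bivariate negative multinomial probabilities add up to one. -/
theorem bivariate_negative_multinomial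
    (n m : ℕ) (hn : 1 ≤ n) (hm : 1 ≤ m)
    (r s : ℝ) (hr0 : 0 < r) (hr1 : r < 1) (hs : s = 1 - r) :
    HasSum (fun i : ℕ => (MC n (m + i) : ℝ) * s ^ i + (MC m (n + i) : ℝ) * r ^ i)
      (1 / (r ^ n * s ^ m)) := by
  have h := aux_main_s11 r s hr0 hr1 hs n m (by omega)
  simpa only [Nat.multichoose_eq, MC] using h
end

section
/- Let n, m, N, M be natural numbers with 1 ≤ n ≤ N and 1 ≤ m ≤ M. Then ∑_{j=0}^{M−m} MC(n, m+j) · C(N−n+M−m−j, N−n) + ∑_{i=0}^{N−n} MC(m, n+i) · C(N−n−i+M−m, M−m) = C(N+M, N), where MC(a,b) = C(a+b−1, b) and C denotes the binomial coefficient. -/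
theorem hyp_tele (p q a b k : ℕ) (hk : k ≤ a + 1) :
    (∑ i ∈ Finset.range k, (p + q + 1 + i).choose q * (a + (b + 1) - i).choose (b + 1)) +
      (p + q + 1).choose (q + 1) * (a + b + 1).choose (b + 1) =
    (∑ i ∈ Finset.range k, (p + (q + 1) + 1 + i).choose (q + 1) * (a + b - i).choose b) +
      (p + q + 1 + k).choose (q + 1) * (a + b + 1 - k).choose (b + 1) := by
  induction k with
  | zero => simp
  | succ k ih =>
    have ih := ih (by omega)
    rw [Finset.sum_range_succ, Finset.sum_range_succ]
    obtain ⟨Y, hY⟩ : ∃ Y, a + b = Y + k := ⟨a + b - k, by omega⟩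
    have e1 : a + (b + 1) - k = Y + 1 := by omega
    have e2 : a + b - k = Y := by omega
    have e3 : a + b + 1 - (k + 1) = Y := by omega
    have e4 : a + b + 1 - k = Y + 1 := by omega
    have e5 : p + (q + 1) + 1 + k = (p + q + 1 + k) + 1 := by omega
    have e6 : p + q + 1 + (k + 1) = (p + q + 1 + k) + 1 := by omega
    rw [e4] at ih
    rw [e1, e2, e3, e5, e6]
    have h1 := Nat.choose_succ_succ' (p + q + 1 + k) q
    have h2 := Nat.choose_succ_succ' Y b
    rw [h1]
    rw [h2] at ih ⊢
    linarith

theorem hyp_base (c q a : ℕ) :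
    c.choose (q + 1) + ∑ i ∈ Finset.range a, (c + i).choose q = (c + a).choose (q + 1) := by
  induction a with
  | zero => simp
  | succ a ih =>
    rw [Finset.sum_range_succ, ← add_assoc, ih, ← add_assoc, Nat.choose_succ_succ']
    ring

theorem hyp_main (p a b q : ℕ) :
    (∑ j ∈ Finset.range (b + 1), (p + q + 1 + j).choose p * (a + b - j).choose a) +
      (∑ i ∈ Finset.range (a + 1), (p + q + 1 + i).choose q * (a + b - i).choose b) =
      (a + b + p + q + 2).choose (a + p + 1) := by
  induction b generalizing q with
  | zero =>
    have h := hyp_base (p + q + 1) q (a + 1)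
    have e : (p + q + 1).choose (q + 1) = (p + q + 1).choose p :=
      (Nat.choose_symm_of_eq_add (by omega))
    have e' : (a + p + q + 2).choose (a + p + 1) = (p + q + 1 + (a + 1)).choose (q + 1) := by
      rw [show p + q + 1 + (a + 1) = a + p + q + 2 by omega]
      exact Nat.choose_symm_of_eq_add (by omega)
    simp [e', ← h, e]
  | succ b ih =>
    have ih := ih (q + 1)
    have t := hyp_tele p q a b (a + 1) le_rfl
    rw [show a + b + 1 - (a + 1) = b by omega, Nat.choose_succ_self] at t
    rw [Finset.sum_range_succ']
    have e : (p + q + 1).choose (q + 1) = (p + q + 1).choose p :=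
      (Nat.choose_symm_of_eq_add (by omega))
    have e2 : (a + b + 1).choose (b + 1) = (a + b + 1).choose a :=
      (Nat.choose_symm_of_eq_add (by omega))
    rw [e, e2] at t
    have s : ∑ j ∈ Finset.range (b + 1), (p + q + 1 + (j + 1)).choose p *
        (a + (b + 1) - (j + 1)).choose a =
        ∑ j ∈ Finset.range (b + 1), (p + (q + 1) + 1 + j).choose p * (a + b - j).choose a := by
      refine Finset.sum_congr rfl fun j _ => ?_
      rw [show p + q + 1 + (j + 1) = p + (q + 1) + 1 + j by omega,
        show a + (b + 1) - (j + 1) = a + b - j by omega]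
    rw [s, show a + (b + 1) + p + q + 2 = a + b + p + (q + 1) + 2 by omega, ← ih]
    simp only [add_zero, Nat.sub_zero, ← add_assoc] at t ⊢
    linarith

/-- bivariate negative hypergeometric probabilities add up to one. -/
theorem bivariate_negative_hypergeometric
    (n m N M : ℕ) (hn : 1 ≤ n) (hnN : n ≤ N) (hm : 1 ≤ m) (hmM : m ≤ M) :
    (∑ j ∈ Finset.range (M - m + 1), MC n (m + j) * (N - n + M - m - j).choose (N - n)) +
      (∑ i ∈ Finset.range (N - n + 1), MC m (n + i) * (N - n - i + M - m).choose (M - m)) =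
      (N + M).choose N := by
  obtain ⟨p, rfl⟩ : ∃ p, n = p + 1 := ⟨n - 1, by omega⟩
  obtain ⟨q, rfl⟩ : ∃ q, m = q + 1 := ⟨m - 1, by omega⟩
  obtain ⟨a, rfl⟩ := Nat.exists_eq_add_of_le hnN
  obtain ⟨b, rfl⟩ := Nat.exists_eq_add_of_le hmM
  have h := hyp_main p a b q
  rw [show p + 1 + a + (q + 1 + b) = a + b + p + q + 2 by omega,
    show p + 1 + a = a + p + 1 by omega, ← h]
  rw [show a + p + 1 - (p + 1) = a by omega, show q + 1 + b - (q + 1) = b by omega]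
  congr 1
  · refine Finset.sum_congr rfl fun j hj => ?_
    rw [show a + (q + 1 + b) - (q + 1) - j = a + b - j by omega]
    congr 1
    unfold MC
    rw [show p + 1 + (q + 1 + j) - 1 = p + q + 1 + j by omega]
    exact Nat.choose_symm_of_eq_add (by omega)
  · refine Finset.sum_congr rfl fun j hj => ?_
    have := Finset.mem_range.mp hj
    rw [show a - j + (q + 1 + b) - (q + 1) = a + b - j by omega]
    congr 1
    unfold MC
    rw [show q + 1 + (p + 1 + j) - 1 = p + q + 1 + j by omega]
    exact Nat.choose_symm_of_eq_add (by omega)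
end

section
/- Let n, m, N, M be natural numbers with n ≥ 1, m ≥ 1, N ≥ 1, M ≥ 1. Then, as real numbers, the series n · MC(N,n) · ∑_{j=m}^{∞} MC(M,j) / MC(n+j, N+M) + m · MC(M,m) · ∑_{i=n}^{∞} MC(N,i) / MC(i+m, N+M) converges and equals N + M, where MC(a,b) = C(a+b−1, b) and C denotes the binomial coefficient. -/
lemma MC_succ_right (M j : ℕ) (hM : 1 ≤ M) :
    ((j : ℝ) + 1) * (MC M (j + 1) : ℝ) = (M + j) * MC M j := by
  obtain ⟨M, rfl⟩ := Nat.exists_eq_add_of_le' hM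
  have h := Nat.add_one_mul_choose_eq (M + j) j
  have e1 : M + 1 + (j + 1) - 1 = M + j + 1 := by omega
  have e2 : M + 1 + j - 1 = M + j := by omega
  unfold MC
  rw [e1, e2]
  have h' : ((M + j + 1 : ℕ) : ℝ) * ((M + j).choose j : ℝ)
      = ((M + j + 1).choose (j + 1) : ℝ) * ((j + 1 : ℕ) : ℝ) := by exact_mod_cast h
  push_cast at h' ⊢
  linarith

lemma MC_succ_left (a K : ℕ) (ha : 1 ≤ a) :
    (a : ℝ) * (MC (a + 1) K : ℝ) = (a + K) * MC a K := by
  obtain ⟨b, rfl⟩ := Nat.exists_eq_add_of_le' ha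
  have h := Nat.choose_mul_succ_eq (b + K) K
  have e0 : b + K + 1 - K = b + 1 := by omega
  have e1 : b + 1 + 1 + K - 1 = b + K + 1 := by omega
  have e2 : b + 1 + K - 1 = b + K := by omega
  rw [e0] at h
  unfold MC
  rw [e1, e2]
  have h' : ((b + K).choose K : ℝ) * ((b + K + 1 : ℕ) : ℝ)
      = ((b + K + 1).choose K : ℝ) * ((b + 1 : ℕ) : ℝ) := by exact_mod_cast h
  push_cast at h' ⊢
  linarith

lemma MC_pos_s13 (a K : ℕ) (ha : 1 ≤ a) : (0 : ℝ) < MC a K := by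
  unfold MC
  exact_mod_cast Nat.choose_pos (by omega)

lemma MC_bound (N M n i : ℕ) (hN : 1 ≤ N) (hM : 1 ≤ M) :
    (i + 1) * ((i + 1) * MC M (i + 1)) ≤ M * (N + M) * MC (n + (i + 1)) (N + M) := by
  obtain ⟨M, rfl⟩ := Nat.exists_eq_add_of_le' hM
  obtain ⟨N, rfl⟩ := Nat.exists_eq_add_of_le' hN
  have h1 := Nat.add_one_mul_choose_eq (M + i) i
  have h2 := Nat.choose_mul_succ_eq (M + i) i
  have e0 : M + i + 1 - i = M + 1 := by omega
  rw [e0] at h2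
  have h3 : (M + i + 1).choose i ≤ (i + (N + M + 1)).choose i :=
    Nat.choose_le_choose _ (by omega)
  have h4 : (i + (N + M + 1)).choose i = (i + (N + M + 1)).choose (N + M + 1) := by
    exact Nat.choose_symm_add
  have h5 := Nat.add_one_mul_choose_eq (i + (N + M + 1)) (N + M + 1)
  have h6 : (i + (N + M + 1) + 1).choose (N + M + 1 + 1)
      ≤ MC (n + (i + 1)) (N + 1 + (M + 1)) := by
    unfold MC
    have : N + 1 + (M + 1) = N + M + 1 + 1 := by omega
    rw [this]
    exact Nat.choose_le_choose _ (by omega)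
  have h7 : MC (M + 1) (i + 1) = (M + i + 1).choose (i + 1) := by
    unfold MC
    congr 1
    omega
  rw [h7]
  calc (i + 1) * ((i + 1) * (M + i + 1).choose (i + 1))
      = (M + 1) * ((i + 1) * (M + i + 1).choose i) := by
        have : (i + 1) * (M + i + 1).choose (i + 1) = (M + 1) * (M + i + 1).choose i := by
          linarith
        rw [this]; ring
    _ ≤ (M + 1) * ((i + (N + M + 1) + 1) * (i + (N + M + 1)).choose (N + M + 1)) := by
        rw [← h4]
        gcongr
        omega
    _ = (M + 1) * ((N + M + 1 + 1) * (i + (N + M + 1) + 1).choose (N + M + 1 + 1)) := by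
        rw [h5]; ring
    _ ≤ (M + 1) * ((N + M + 1 + 1) * MC (n + (i + 1)) (N + 1 + (M + 1))) := by
        gcongr
    _ = _ := by ring

noncomputable def tt (N M n j : ℕ) : ℝ := (MC M j : ℝ) / (MC (n + j) (N + M) : ℝ)

lemma tt_nonneg (N M n j : ℕ) : 0 ≤ tt N M n j := by unfold tt; positivity

lemma tt_bound (N M n i : ℕ) (hN : 1 ≤ N) (hM : 1 ≤ M) :
    ((i : ℝ) + 1) * (((i : ℝ) + 1) * tt N M n (i + 1)) ≤ M * (N + M) := by
  have hp := MC_pos_s13 (n + (i + 1)) (N + M) (by omega)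
  have h : ((i : ℝ) + 1) * (((i : ℝ) + 1) * MC M (i + 1))
      ≤ M * (N + M) * MC (n + (i + 1)) (N + M) := by
    exact_mod_cast MC_bound N M n i hN hM
  unfold tt
  rw [← mul_div_assoc, ← mul_div_assoc, div_le_iff₀ hp]
  exact h

lemma tt_summable (N M n : ℕ) (hN : 1 ≤ N) (hM : 1 ≤ M) : Summable (tt N M n) := by
  rw [← summable_nat_add_iff 1]
  have h2 : Summable (fun i : ℕ => ((M : ℝ) * (N + M)) * (1 / ((i + 1 : ℕ) : ℝ) ^ 2)) :=
    ((summable_nat_add_iff 1).2 (Real.summable_one_div_nat_pow.2 one_lt_two)).mul_left _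
  refine Summable.of_nonneg_of_le (fun i => tt_nonneg _ _ _ _) (fun i => ?_) h2
  have h := tt_bound N M n i hN hM
  have hi : (0 : ℝ) < ((i + 1 : ℕ) : ℝ) ^ 2 := by positivity
  rw [mul_one_div, le_div_iff₀ hi]
  push_cast
  linarith

open Filter Topology in
lemma tt_tendsto (N M n : ℕ) (hN : 1 ≤ N) (hM : 1 ≤ M) :
    Tendsto (fun j : ℕ => (j : ℝ) * tt N M n j) atTop (𝓝 0) := by
  rw [← tendsto_add_atTop_iff_nat 1]
  have h2 : Tendsto (fun i : ℕ => ((M : ℝ) * (N + M)) * (1 / ((i : ℝ) + 1))) atTop (𝓝 0) := by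
    simpa using (tendsto_one_div_add_atTop_nhds_zero_nat (𝕜 := ℝ)).const_mul ((M : ℝ) * (N + M))
  refine squeeze_zero (fun i => mul_nonneg (by positivity) (tt_nonneg _ _ _ _)) (fun i => ?_) h2
  have h := tt_bound N M n i hN hM
  have hi : (0 : ℝ) < (i : ℝ) + 1 := by positivity
  rw [mul_one_div, le_div_iff₀ hi]
  push_cast
  linarith

lemma tt_sum_shift (N M n m : ℕ) (hN : 1 ≤ N) (hM : 1 ≤ M) :
    Summable (fun j => tt N M n (m + j)) := by
  have := (summable_nat_add_iff m).2 (tt_summable N M n hN hM)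
  simpa [add_comm] using this

noncomputable def TT (N M n m : ℕ) : ℝ := ∑' j, tt N M n (m + j)

open Filter Topology in
lemma hasSum_tele (u f : ℕ → ℝ) (hf : Summable f) (h : ∀ j, f j = u j - u (j + 1))
    (hu : Tendsto u atTop (𝓝 0)) : ∑' j, f j = u 0 := by
  have h1 := hf.hasSum.tendsto_sum_nat
  have h2 : (fun k => ∑ j ∈ Finset.range k, f j) = fun k => u 0 - u k := by
    funext k
    simp only [h]
    exact Finset.sum_range_sub' u k
  rw [h2] at h1
  have h3 : Tendsto (fun k => u 0 - u k) atTop (𝓝 (u 0 - 0)) := tendsto_const_nhds.sub hu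
  rw [sub_zero] at h3
  exact tendsto_nhds_unique h1 h3

lemma tt_rec (N M n j : ℕ) (hM : 1 ≤ M) (hnj : 1 ≤ n + j) :
    ((N : ℝ) + n) * tt N M (n + 1) j - n * tt N M n j
      = j * tt N M n j - ((j + 1 : ℕ) : ℝ) * tt N M n (j + 1) := by
  have h1 := MC_succ_right M j hM
  have h2 := MC_succ_left (n + j) (N + M) hnj
  have p1 := MC_pos_s13 (n + j) (N + M) hnj
  have p2 := MC_pos_s13 (n + j + 1) (N + M) (by omega)
  unfold tt
  have e1 : n + 1 + j = n + j + 1 := by ring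
  have e2 : n + (j + 1) = n + j + 1 := by ring
  rw [e1, e2]
  push_cast at *
  rw [← mul_div_assoc ((j : ℝ) + 1), h1]
  field_simp
  linear_combination (-(MC M j : ℝ)) * h2

open Filter Topology in
lemma TT_rec (N M n m : ℕ) (hN : 1 ≤ N) (hM : 1 ≤ M) (hnm : 1 ≤ n + m) :
    ((N : ℝ) + n) * TT N M (n + 1) m - n * TT N M n m = m * tt N M n m := by
  have s1 := tt_sum_shift N M (n + 1) m hN hM
  have s2 := tt_sum_shift N M n m hN hM
  unfold TT
  rw [← tsum_mul_left, ← tsum_mul_left, ← (s1.mul_left _).tsum_sub (s2.mul_left _)]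
  rw [hasSum_tele (fun j => ((m + j : ℕ) : ℝ) * tt N M n (m + j)) _
    ((s1.mul_left _).sub (s2.mul_left _))]
  · simp
  · intro j
    exact tt_rec N M n (m + j) hM (by omega)
  · have := (tendsto_add_atTop_iff_nat m).2 (tt_tendsto N M n hN hM)
    simpa only [add_comm] using this

open Filter Topology in
lemma TT_base (N M : ℕ) (hN : 1 ≤ N) (hM : 1 ≤ M) :
    (N : ℝ) * TT N M 1 0 = N + M := by
  have s1 := tt_sum_shift N M 1 0 hN hM
  unfold TT
  rw [← tsum_mul_left]
  rw [hasSum_tele (fun j => ((j : ℝ) + (N + M)) * tt N M 1 j) _ (s1.mul_left _)]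
  · simp [tt, MC]
  · intro j
    have h1 := MC_succ_right M j hM
    have h2 := MC_succ_left (1 + j) (N + M) (by omega)
    have p1 := MC_pos_s13 (1 + j) (N + M) (by omega)
    have p2 := MC_pos_s13 (1 + j + 1) (N + M) (by omega)
    unfold tt
    rw [zero_add, ← add_assoc 1 j 1]
    push_cast at *
    have h1' : (MC M (j + 1) : ℝ) = (M + j) * MC M j / (j + 1) := by
      field_simp; linarith
    have h2' : (MC (1 + j + 1) (N + M) : ℝ)
        = (1 + j + (N + M)) * MC (1 + j) (N + M) / (1 + j) := by
      field_simp; linarith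
    rw [h1', h2']
    have : (0 : ℝ) < 1 + j + (N + M) := by positivity
    field_simp
    ring
  · have a := tt_tendsto N M 1 hN hM
    have b := (tt_summable N M 1 hN hM).tendsto_atTop_zero.const_mul ((N : ℝ) + M)
    have := a.add b
    simp only [mul_zero, add_zero] at this
    refine this.congr fun j => ?_
    ring

lemma TT_zero (N M n : ℕ) (hN : 1 ≤ N) (hM : 1 ≤ M) :
    ((n + 1 : ℕ) : ℝ) * MC N (n + 1) * TT N M (n + 1) 0 = N + M := by
  induction n with
  | zero =>
    have := TT_base N M hN hM
    have h := MC_succ_right N 0 hN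
    simp [MC] at h ⊢
    simpa [h] using this
  | succ n ih =>
    have h := TT_rec N M (n + 1) 0 hN hM (by omega)
    have h1 := MC_succ_right N (n + 1) hN
    rw [← ih]
    push_cast at *
    rw [h1]
    linear_combination (MC N (n + 1) : ℝ) * h

lemma tt_swap (N M n m : ℕ) : (MC N n : ℝ) * tt N M n m = MC M m * tt M N m n := by
  unfold tt
  rw [add_comm n m, add_comm N M]
  ring

lemma TT_succ (N M n m : ℕ) (hN : 1 ≤ N) (hM : 1 ≤ M) (h0 : 1 ≤ n + m) :
    TT M N m n = tt M N m n + TT M N m (n + 1) := by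
  have := (tt_sum_shift M N m n hM hN).tsum_eq_zero_add
  unfold TT
  rw [this]
  simp [add_assoc, add_comm 1]

lemma TT_main (N M n m : ℕ) (hN : 1 ≤ N) (hM : 1 ≤ M) (hm : 1 ≤ m) :
    (n : ℝ) * MC N n * TT N M n m + m * MC M m * TT M N m n = N + M := by
  induction n with
  | zero =>
    obtain ⟨k, rfl⟩ := Nat.exists_eq_add_of_le' hm
    have := TT_zero M N k hM hN
    simp only [Nat.cast_zero, zero_mul, zero_add]
    linarith
  | succ n ih =>
    have h := TT_rec N M n m hN hM (by omega)
    have h1 := MC_succ_right N n hN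
    have h2 := TT_succ N M n m hN hM (by omega)
    have h3 := tt_swap N M n m
    rw [← ih, h2]
    push_cast
    rw [h1]
    linear_combination (MC N n : ℝ) * h + (m : ℝ) * h3

/-- bivariate negative Pólya probabilities add up to one:
both tail series converge and the combination equals `N + M`. -/
theorem bivariate_negative_polya
    (n m N M : ℕ) (hn : 1 ≤ n) (hm : 1 ≤ m) (hN : 1 ≤ N) (hM : 1 ≤ M) :
    Summable (fun j : ℕ => (MC M (m + j) : ℝ) / (MC (n + (m + j)) (N + M) : ℝ)) ∧
    Summable (fun i : ℕ => (MC N (n + i) : ℝ) / (MC ((n + i) + m) (N + M) : ℝ)) ∧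
    (n : ℝ) * (MC N n : ℝ) *
        (∑' j : ℕ, (MC M (m + j) : ℝ) / (MC (n + (m + j)) (N + M) : ℝ)) +
      (m : ℝ) * (MC M m : ℝ) *
        (∑' i : ℕ, (MC N (n + i) : ℝ) / (MC ((n + i) + m) (N + M) : ℝ))
      = (N : ℝ) + (M : ℝ) := by
  refine ⟨tt_sum_shift N M n m hN hM, ?_, ?_⟩
  · have := tt_sum_shift M N m n hM hN
    refine this.congr fun i => ?_
    unfold tt
    rw [add_comm m, add_comm M N]
  · have h := TT_main N M n m hN hM hm
    have e : TT M N m n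
        = ∑' i : ℕ, (MC N (n + i) : ℝ) / (MC ((n + i) + m) (N + M) : ℝ) := by
      unfold TT
      refine tsum_congr fun i => ?_
      unfold tt
      rw [add_comm m, add_comm M N]
    rw [← e]
    exact h
end

section
/- Let X be a finite set, let υ : X → ℕ be an urn of size L = ∑_{x∈X} υ(x), and let φ : X → ℕ with φ ≤ υ pointwise and K = ∑_{x∈X} φ(x), where K ≤ L and L ≥ 1. Then, as real numbers, (∏_{x∈X} C(υ(x), φ(x))) / C(L, K) = ∑_{(x₁,…,x_K)} ∏_{i=0}^{K−1} (υ(x_{i+1}) − aᵢ(x_{i+1})) / (L − i), where the sum ranges over all tuples (x₁,…,x_K) ∈ X^K whose accumulation equals φ, and aᵢ denotes the accumulation of the prefix (x₁,…,xᵢ) (with a₀ the empty multiset). -/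
/-- The accumulation of a tuple: `acc v x` counts the indices `i` with `v i = x`. -/
def acc {X : Type*} [DecidableEq X] {K : ℕ} (v : Fin K → X) (x : X) : ℕ :=
  (Finset.univ.filter fun i => v i = x).card

/-- The accumulation of the length-`i` prefix of a tuple. -/
def prefAcc {X : Type*} [DecidableEq X] {K : ℕ} (v : Fin K → X) (i : ℕ) (x : X) : ℕ :=
  (Finset.univ.filter fun j : Fin K => (j : ℕ) < i ∧ v j = x).card

lemma acc_snoc {X : Type*} [DecidableEq X] {K : ℕ} (w : Fin K → X) (y x : X) :
    acc (Fin.snoc w y : Fin (K+1) → X) x = acc w x + if y = x then 1 else 0 := by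
  simp only [acc, Finset.card_filter, Fin.sum_univ_castSucc, Fin.snoc_castSucc, Fin.snoc_last]

lemma prefAcc_snoc_castSucc {X : Type*} [DecidableEq X] {K : ℕ} (w : Fin K → X) (y x : X)
    (i : Fin K) :
    prefAcc (Fin.snoc w y : Fin (K+1) → X) i x = prefAcc w i x := by
  simp only [prefAcc, Finset.card_filter, Fin.sum_univ_castSucc, Fin.snoc_castSucc, Fin.snoc_last]
  have : ¬ (K < (i : ℕ)) := by omega
  simp [this]

lemma prefAcc_snoc_last {X : Type*} [DecidableEq X] {K : ℕ} (w : Fin K → X) (y x : X) :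
    prefAcc (Fin.snoc w y : Fin (K+1) → X) K x = acc w x := by
  simp only [acc, prefAcc, Finset.card_filter, Fin.sum_univ_castSucc, Fin.snoc_castSucc,
    Fin.snoc_last]
  simp

lemma aux_main_s18 (X : Type*) [Fintype X] [DecidableEq X] (υ : X → ℕ) (K : ℕ) :
    ∀ (φ : X → ℕ) (hφ : ∀ x, φ x ≤ υ x) (hK : ∑ x, φ x = K),
    (∏ x, ((υ x).choose (φ x) : ℝ)) / ((∑ x, υ x).choose K : ℝ)
      = ∑ v : Fin K → X, if (∀ x, acc v x = φ x) then
          ∏ i : Fin K,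
            (((υ (v i) : ℕ) : ℝ) - ((prefAcc v i (v i) : ℕ) : ℝ)) /
              ((((∑ x, υ x : ℕ)) : ℝ) - ((i : ℕ) : ℝ)) else 0 := by
  induction K with
  | zero =>
    intro φ hφ hK
    have h0 : ∀ x, φ x = 0 := by simpa using hK
    simp [h0, acc]
  | succ K ih =>
    intro φ hφ hK
    have hKL : K + 1 ≤ ∑ x, υ x := hK ▸ Finset.sum_le_sum (fun x _ => hφ x)
    generalize hLdef : ∑ x, υ x = L at *
    rw [← Equiv.sum_comp (Fin.snocEquiv (fun _ => X)), Fintype.sum_prod_type]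
    have hLK : (L : ℝ) - K ≠ 0 := by
      have : (K : ℝ) + 1 ≤ L := by exact_mod_cast hKL
      linarith
    have hc : (L.choose (K+1) : ℝ) ≠ 0 := by
      exact_mod_cast (Nat.choose_pos hKL).ne'
    have hc' : (L.choose K : ℝ) ≠ 0 := by
      exact_mod_cast (Nat.choose_pos (by omega : K ≤ L)).ne'
    have hrec : (L.choose (K+1) : ℝ) * (K + 1) = L.choose K * (L - K) := by
      have := Nat.choose_succ_right_eq L K
      rw [← Nat.cast_sub (by omega : K ≤ L)]
      exact_mod_cast this
    have key : ∀ y : X, (∑ w : Fin K → X,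
        if (∀ x, acc (Fin.snocEquiv (fun _ => X) (y, w)) x = φ x) then
          ∏ i : Fin (K+1),
            (((υ (Fin.snocEquiv (fun _ => X) (y, w) i) : ℕ) : ℝ) -
              ((prefAcc (Fin.snocEquiv (fun _ => X) (y, w)) i
                (Fin.snocEquiv (fun _ => X) (y, w) i) : ℕ) : ℝ)) /
              ((L : ℝ) - ((i : ℕ) : ℝ)) else 0) =
        (∏ x, ((υ x).choose (φ x) : ℝ)) * φ y / (L.choose (K+1) * (K+1)) := by
      intro y
      have e : ∀ w : Fin K → X, Fin.snocEquiv (fun _ => X) (y, w) =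
        (Fin.snoc w y : Fin (K+1) → X) := fun w => rfl
      simp only [e, acc_snoc]
      rcases Nat.eq_zero_or_pos (φ y) with h | h
      · rw [h]
        simp only [Nat.cast_zero, mul_zero, zero_div]
        apply Finset.sum_eq_zero
        intro w _
        rw [if_neg]
        intro hh
        have := hh y
        simp [h] at this
      · have hy := hφ y
        have hsum : ∑ x, Function.update φ y (φ y - 1) x = K := by
          rw [Finset.sum_update_of_mem (Finset.mem_univ y)]
          have := Finset.add_sum_erase Finset.univ φ (Finset.mem_univ y)
          rw [← Finset.erase_eq]
          omega
        have hle : ∀ x, Function.update φ y (φ y - 1) x ≤ υ x := by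
          intro x
          by_cases hx : x = y
          · subst hx; simp; omega
          · simp [hx, hφ x]
        have I := ih _ hle hsum
        have hcond : ∀ w : Fin K → X, (∀ x, acc w x + (if y = x then 1 else 0) = φ x) ↔
            ∀ x, acc w x = Function.update φ y (φ y - 1) x := by
          intro w
          refine forall_congr' fun x => ?_
          by_cases hx : x = y
          · subst hx; simp; omega
          · simp [hx, Ne.symm hx]
        have step : ∀ w : Fin K → X,
          (if (∀ x, acc w x + (if y = x then 1 else 0) = φ x) then
          ∏ i : Fin (K+1),
            (((υ ((Fin.snoc w y : Fin (K+1) → X) i) : ℕ) : ℝ) -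
              ((prefAcc (Fin.snoc w y : Fin (K+1) → X) i
                ((Fin.snoc w y : Fin (K+1) → X) i) : ℕ) : ℝ)) /
              ((L : ℝ) - ((i : ℕ) : ℝ)) else 0) =
          (if (∀ x, acc w x = Function.update φ y (φ y - 1) x) then
            ∏ i : Fin K, (((υ (w i) : ℕ) : ℝ) - ((prefAcc w i (w i) : ℕ) : ℝ)) /
              ((L : ℝ) - ((i : ℕ) : ℝ)) else 0) * ((υ y - (φ y - 1)) / (L - K)) := by
          intro w
          simp only [hcond w]
          split_ifs with hw
          · rw [Fin.prod_univ_castSucc]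
            simp only [Fin.snoc_castSucc, Fin.snoc_last, Fin.val_castSucc, Fin.val_last,
              prefAcc_snoc_castSucc, prefAcc_snoc_last]
            rw [hw y]
            simp [Nat.cast_sub (Nat.succ_le_of_lt h)]
          · simp
        rw [Finset.sum_congr rfl (fun w _ => step w), ← Finset.sum_mul, ← I]
        have hch : ((υ y).choose (φ y) : ℝ) * φ y =
            (υ y).choose (φ y - 1) * (υ y - (φ y - 1)) := by
          obtain ⟨m, hm⟩ : ∃ m, φ y = m + 1 := ⟨φ y - 1, by omega⟩
          rw [hm] at hy ⊢
          have := Nat.choose_succ_right_eq (υ y) m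
          have h2 : ((υ y - m : ℕ) : ℝ) = υ y - m := Nat.cast_sub (by omega)
          simp only [Nat.add_sub_cancel]
          push_cast
          rw [add_sub_cancel_right, ← h2]
          exact_mod_cast this
        rw [← Finset.mul_prod_erase Finset.univ _ (Finset.mem_univ y),
          ← Finset.mul_prod_erase Finset.univ (fun x => ((υ x).choose (φ x) : ℝ))
            (Finset.mem_univ y)]
        have hP : ∏ x ∈ Finset.univ.erase y,
            ((υ x).choose (Function.update φ y (φ y - 1) x) : ℝ) =
            ∏ x ∈ Finset.univ.erase y, ((υ x).choose (φ x) : ℝ) := by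
          refine Finset.prod_congr rfl fun x hx => ?_
          rw [Function.update_of_ne (Finset.ne_of_mem_erase hx)]
        rw [hP, Function.update_self, hrec, mul_right_comm, hch, div_mul_div_comm]
        ring
    rw [Finset.sum_congr rfl (fun y _ => key y), ← Finset.sum_div, ← Finset.mul_sum]
    have : (∑ x, (φ x : ℝ)) = K + 1 := by exact_mod_cast hK
    rw [this]
    have hK1 : (K : ℝ) + 1 ≠ 0 := by positivity
    field_simp

/-- the hypergeometric probability of a draw `φ ≤ υ` equals the
sum, over all tuples accumulating to `φ`, of the products of the successive
draw-without-replacement probabilities. -/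
theorem hypergeometric_eq_sum_over_sequences
    (X : Type*) [Fintype X] [DecidableEq X]
    (υ φ : X → ℕ) (hφ : ∀ x, φ x ≤ υ x)
    (K : ℕ) (hK : ∑ x, φ x = K) (hKL : K ≤ ∑ x, υ x) (hL : 1 ≤ ∑ x, υ x) :
    (∏ x, ((υ x).choose (φ x) : ℝ)) / ((∑ x, υ x).choose K : ℝ)
      = ∑ v ∈ Finset.univ.filter (fun v : Fin K → X => ∀ x, acc v x = φ x),
          ∏ i : Fin K,
            (((υ (v i) : ℕ) : ℝ) - ((prefAcc v i (v i) : ℕ) : ℝ)) /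
              ((((∑ x, υ x : ℕ)) : ℝ) - ((i : ℕ) : ℝ)) := by
  rw [Finset.sum_filter]
  exact aux_main_s18 X υ K φ hφ hK
end
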